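/- arXiv:1207.6535 — 2 statements merged into one kernel-verified Lean document; each statement's English description precedes it below -/
import Mathlib

section
/- Comparison principle under strict monotonicity in u (Proposition 3.6). Assume the Hamiltonian H = (H^j) satisfies (H0), (H1) and moreover (Hr): for every j ∈ J, y ∈ [0,l_j] and p ∈ ℝ the map r ↦ H^j(y,r,p) is strictly increasing. Let β = (β_{ij}) be weights with β_{ij} > 0 for every i ∈ I_T and j ∈ Inc_i, let ε > 0, and let w₁, w₂ ∈ C²(Γ) satisfy (CP). Then w₁ ≥ w₂ everywhere on Γ. -/
open Set

noncomputable section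

/-- A finite connected topological network. -/
structure Network where
  I : Type
  J : Type
  finI : Fintype I
  finJ : Fintype J
  neI : Nonempty I
  neJ : Nonempty J
  l : J → ℝ
  l_pos : ∀ j, 0 < l j
  s : J → I
  t : J → I
  st_ne : ∀ j, s j ≠ t j
  conn : ∀ i i' : I,
    Relation.ReflTransGen (fun a b => ∃ j, (s j = a ∧ t j = b) ∨ (s j = b ∧ t j = a)) i i'
  IB : Set I
  IB_ne : IB.Nonempty
  deg_one_bd : ∀ i : I, ({j : J | s j = i ∨ t j = i} : Set J).ncard = 1 → i ∈ IB

attribute [instance] Network.finI Network.finJ Network.neI Network.neJ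

namespace Network

open scoped Classical

variable (N : Network)

/-- The set of edges incident to the vertex `i`. -/
def Inc (i : N.I) : Set N.J := {j | N.s j = i ∨ N.t j = i}

/-- The set of transition vertices. -/
def IT : Set N.I := N.IBᶜ

/-- The signed incidence `a_{ij}`. -/
def sgn (i : N.I) (j : N.J) : ℝ := if N.s j = i then 1 else -1

/-- The parameter `y_i^j` of the vertex `i` on the edge `j`. -/
def param (i : N.I) (j : N.J) : ℝ := if N.s j = i then 0 else N.l j

/-- The edge `j` as a parameter interval. -/
def edge (j : N.J) : Set ℝ := Icc 0 (N.l j)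

/-- A family `(u^j)` of functions on the edges defines a function on the network iff
the values at each vertex agree. -/
def Compat (u : N.J → ℝ → ℝ) : Prop :=
  ∀ i : N.I, ∀ j ∈ N.Inc i, ∀ k ∈ N.Inc i, u j (N.param i j) = u k (N.param i k)

/-- `u ∈ C(Γ)`. -/
def IsCont (u : N.J → ℝ → ℝ) : Prop :=
  N.Compat u ∧ ∀ j, ContinuousOn (u j) (N.edge j)

/-- `u ∈ C²(Γ)`. -/
def IsC2 (u : N.J → ℝ → ℝ) : Prop :=
  N.Compat u ∧ ∀ j, ContDiffOn ℝ 2 (u j) (N.edge j)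

/-- First derivative `∂_j u` along the edge `j`. -/
def pd (u : N.J → ℝ → ℝ) (j : N.J) (x : ℝ) : ℝ := derivWithin (u j) (N.edge j) x

/-- Second derivative `∂²_j u` along the edge `j`. -/
def pd2 (u : N.J → ℝ → ℝ) (j : N.J) (x : ℝ) : ℝ := derivWithin (N.pd u j) (N.edge j) x

/-- Sum over the edges incident to `i`. -/
def incSum (i : N.I) (f : N.J → ℝ) : ℝ := ∑ j : N.J, if j ∈ N.Inc i then f j else 0

/-- The Kirchhoff sum `S^i_β u`. -/
def kir (β : N.I → N.J → ℝ) (u : N.J → ℝ → ℝ) (i : N.I) : ℝ :=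
  N.incSum i (fun j => β i j * N.sgn i j * N.pd u j (N.param i j))

/-- `u ∈ C²_{*,β}(Γ)`. -/
def IsC2Star (β : N.I → N.J → ℝ) (u : N.J → ℝ → ℝ) : Prop :=
  N.IsC2 u ∧ ∀ i ∈ N.IT, N.kir β u i = 0

/-- (H0): continuity of each `H^j`. -/
def H0 (H : N.J → ℝ → ℝ → ℝ → ℝ) : Prop :=
  ∀ j, ContinuousOn (fun q : ℝ × ℝ × ℝ => H j q.1 q.2.1 q.2.2)
    ((N.edge j) ×ˢ (univ : Set ℝ) ×ˢ (univ : Set ℝ))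

/-- (H1): `r ↦ H^j(x,r,p)` is nondecreasing. -/
def H1 (H : N.J → ℝ → ℝ → ℝ → ℝ) : Prop :=
  ∀ j, ∀ x ∈ N.edge j, ∀ p : ℝ, Monotone fun r => H j x r p

/-- (H3): `p ↦ H^j(v_i,r,p)` is nondecreasing on `(0,∞)` at transition vertices. -/
def H3 (H : N.J → ℝ → ℝ → ℝ → ℝ) : Prop :=
  ∀ i ∈ N.IT, ∀ j ∈ N.Inc i, ∀ r : ℝ,
    MonotoneOn (fun p => H j (N.param i j) r p) (Ioi (0 : ℝ))

/-- (H4): coercivity in `p`, uniform on bounded `r`-sets. -/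
def H4 (H : N.J → ℝ → ℝ → ℝ → ℝ) : Prop :=
  ∀ j, ∀ R : ℝ, 0 < R → ∀ A : ℝ, ∃ M : ℝ, ∀ x ∈ N.edge j, ∀ r : ℝ, |r| ≤ R →
    ∀ p : ℝ, M < |p| → A < H j x r p

/-- (H5): continuity of `H` at the transition vertices. -/
def H5 (H : N.J → ℝ → ℝ → ℝ → ℝ) : Prop :=
  ∀ i ∈ N.IT, ∀ j ∈ N.Inc i, ∀ k ∈ N.Inc i, ∀ r p : ℝ,
    H j (N.param i j) r p = H k (N.param i k) r p

/-- (H6): symmetry of `H` in `p` at the transition vertices. -/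
def H6 (H : N.J → ℝ → ℝ → ℝ → ℝ) : Prop :=
  ∀ i ∈ N.IT, ∀ j ∈ N.Inc i, ∀ r p : ℝ,
    H j (N.param i j) r p = H j (N.param i j) r (-p)

end Network

/-- The hypotheses (CP) of the comparison principles: `w₁` is a supersolution and `w₂` a
subsolution of the viscous equation, the Kirchhoff sums are ordered, and the boundary
values are ordered. -/
def Network.CP (N : Network) (H : N.J → ℝ → ℝ → ℝ → ℝ) (β : N.I → N.J → ℝ) (ε : ℝ)
    (w₁ w₂ : N.J → ℝ → ℝ) : Prop :=
  (∀ j, ∀ x ∈ N.edge j,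
    -ε * N.pd2 w₂ j x + H j x (w₂ j x) (N.pd w₂ j x) ≤
      -ε * N.pd2 w₁ j x + H j x (w₁ j x) (N.pd w₁ j x)) ∧
  (∀ i ∈ N.IT, N.kir β w₁ i ≤ N.kir β w₂ i) ∧
  (∀ i ∈ N.IB, ∀ j ∈ N.Inc i, w₂ j (N.param i j) ≤ w₁ j (N.param i j))
/-- First-order condition at a maximum point over an interval, endpoints included. -/
theorem IsMaxOn.derivWithin_mul_sub_nonpos {f : ℝ → ℝ} {a b x y : ℝ}
    (hx : x ∈ Icc a b) (hy : y ∈ Icc a b) (hmax : IsMaxOn f (Icc a b) x)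
    (hf : DifferentiableWithinAt ℝ f (Icc a b) x) :
    derivWithin f (Icc a b) x * (y - x) ≤ 0 := by
  have hcone : y - x ∈ posTangentConeAt (Icc a b) x :=
    sub_mem_posTangentConeAt_of_segment_subset ((convex_Icc a b).segment_subset hx hy)
  have h := hmax.localize.hasFDerivWithinAt_nonpos
    hf.hasDerivWithinAt.hasFDerivWithinAt hcone
  simpa [mul_comm] using h

/-- Second-order condition at a critical maximum point over an interval, endpoints included. -/
theorem IsMaxOn.second_derivWithin_nonpos {f : ℝ → ℝ} {a b x c : ℝ} (hab : a < b)
    (hx : x ∈ Icc a b) (hmax : IsMaxOn f (Icc a b) x)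
    (hf : DifferentiableOn ℝ f (Icc a b)) (hcrit : derivWithin f (Icc a b) x = 0)
    (hc : HasDerivWithinAt (derivWithin f (Icc a b)) c (Icc a b) x) : c ≤ 0 := by
  by_contra! hpos
  have hev := (hasDerivWithinAt_iff_tendsto_slope.1 hc).eventually (lt_mem_nhds hpos)
  obtain ⟨δ, hδ, hball⟩ := Metric.mem_nhdsWithin_iff.1 hev
  have hslope : ∀ y ∈ Icc a b, y ≠ x → |y - x| < δ →
      0 < derivWithin f (Icc a b) y / (y - x) := by
    intro y hy hne hd
    have h : 0 < slope (derivWithin f (Icc a b)) x y :=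
      hball ⟨by simpa [Real.dist_eq] using hd, hy, hne⟩
    rwa [slope_def_field, hcrit, sub_zero] at h
  have hd : ∀ y ∈ Ioo a b, HasDerivAt f (derivWithin f (Icc a b) y) y := fun y hy =>
    (hf y (Ioo_subset_Icc_self hy)).hasDerivWithinAt.hasDerivAt (Icc_mem_nhds hy.1 hy.2)
  rcases lt_or_ge x b with hxb | hxb
  · obtain ⟨y, hxy, hy⟩ := exists_between (lt_min hxb (lt_add_of_pos_right x hδ))
    obtain ⟨hyb, hyδ⟩ := lt_min_iff.1 hy
    obtain ⟨z, hz, hzeq⟩ := exists_hasDerivAt_eq_slope f (derivWithin f (Icc a b)) hxy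
      (hf.continuousOn.mono (Icc_subset_Icc hx.1 hyb.le))
      (fun z hz => hd z ⟨hx.1.trans_lt hz.1, hz.2.trans hyb⟩)
    have h1 := hslope z ⟨hx.1.trans hz.1.le, (hz.2.trans hyb).le⟩ hz.1.ne'
      (by rw [abs_of_pos (sub_pos.2 hz.1)]; linarith [hz.2])
    have h2 := (div_pos_iff_of_pos_right (sub_pos.2 hz.1)).1 h1
    rw [hzeq, div_pos_iff_of_pos_right (sub_pos.2 hxy)] at h2
    have h3 : f y ≤ f x := hmax ⟨hx.1.trans hxy.le, hyb.le⟩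
    linarith
  · have hax : a < x := hab.trans_le hxb
    obtain ⟨y, hy, hyx⟩ := exists_between (max_lt hax (sub_lt_self x hδ))
    obtain ⟨hay, hyδ⟩ := max_lt_iff.1 hy
    obtain ⟨z, hz, hzeq⟩ := exists_hasDerivAt_eq_slope f (derivWithin f (Icc a b)) hyx
      (hf.continuousOn.mono (Icc_subset_Icc hay.le hx.2))
      (fun z hz => hd z ⟨hay.trans hz.1, hz.2.trans_le hx.2⟩)
    have h1 := hslope z ⟨(hay.trans hz.1).le, hz.2.le.trans hx.2⟩ hz.2.ne
      (by rw [abs_of_neg (sub_neg.2 hz.2)]; linarith [hz.1])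
    have h2 : derivWithin f (Icc a b) z < 0 := by
      by_contra! h
      exact absurd h1 (div_nonpos_of_nonneg_of_nonpos h (sub_neg.2 hz.2).le).not_gt
    rw [hzeq, div_neg_iff] at h2
    have h3 : f y ≤ f x := hmax ⟨hay.le, hyx.le.trans hx.2⟩
    rcases h2 with h2 | h2 <;> linarith [h2.1, h2.2]

namespace Network

variable {N : Network}

theorem param_mem_edge (i : N.I) (j : N.J) : N.param i j ∈ N.edge j := by
  unfold param edge
  split_ifs
  · exact ⟨le_rfl, (N.l_pos j).le⟩
  · exact ⟨(N.l_pos j).le, le_rfl⟩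

theorem uniqueDiffOn_edge (j : N.J) : UniqueDiffOn ℝ (N.edge j) :=
  uniqueDiffOn_Icc (N.l_pos j)

theorem IsC2.differentiableOn {u : N.J → ℝ → ℝ} (hu : N.IsC2 u) (j : N.J) :
    DifferentiableOn ℝ (u j) (N.edge j) :=
  (hu.2 j).differentiableOn (by norm_num)

theorem IsC2.differentiableOn_pd {u : N.J → ℝ → ℝ} (hu : N.IsC2 u) (j : N.J) :
    DifferentiableOn ℝ (N.pd u j) (N.edge j) :=
  ((hu.2 j).derivWithin (m := 1) (uniqueDiffOn_edge j) (by norm_num)).differentiableOn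
    (by norm_num)

theorem IsC2.sub {u v : N.J → ℝ → ℝ} (hu : N.IsC2 u) (hv : N.IsC2 v) :
    N.IsC2 (fun j x => u j x - v j x) :=
  ⟨fun i j hj k hk => congrArg₂ (· - ·) (hu.1 i j hj k hk) (hv.1 i j hj k hk),
    fun j => (hu.2 j).sub (hv.2 j)⟩

theorem pd_sub {u v : N.J → ℝ → ℝ} (hu : N.IsC2 u) (hv : N.IsC2 v) {j : N.J} {x : ℝ}
    (hx : x ∈ N.edge j) :
    N.pd (fun j x => u j x - v j x) j x = N.pd u j x - N.pd v j x :=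
  derivWithin_fun_sub (hu.differentiableOn j x hx) (hv.differentiableOn j x hx)

theorem pd2_sub {u v : N.J → ℝ → ℝ} (hu : N.IsC2 u) (hv : N.IsC2 v) {j : N.J} {x : ℝ}
    (hx : x ∈ N.edge j) :
    N.pd2 (fun j x => u j x - v j x) j x = N.pd2 u j x - N.pd2 v j x :=
  (derivWithin_congr (fun _ hy => pd_sub hu hv hy) (pd_sub hu hv hx)).trans
    (derivWithin_fun_sub (hu.differentiableOn_pd j x hx) (hv.differentiableOn_pd j x hx))

theorem kir_sub {u v : N.J → ℝ → ℝ} (hu : N.IsC2 u) (hv : N.IsC2 v)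
    (β : N.I → N.J → ℝ) (i : N.I) :
    N.kir β (fun j x => u j x - v j x) i = N.kir β u i - N.kir β v i := by
  unfold kir incSum
  rw [← Finset.sum_sub_distrib]
  refine Finset.sum_congr rfl fun j _ => ?_
  simp only [pd_sub hu hv (param_mem_edge i j)]
  split_ifs <;> ring

/-- A continuous function on a network attains its maximum. -/
theorem exists_max {u : N.J → ℝ → ℝ} (hu : ∀ j, ContinuousOn (u j) (N.edge j)) :
    ∃ j, ∃ x ∈ N.edge j, ∀ k, ∀ y ∈ N.edge k, u k y ≤ u j x := by
  have hne : ∀ j, (N.edge j).Nonempty := fun j => nonempty_Icc.2 (N.l_pos j).le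
  choose m hm hmax using fun j => isCompact_Icc.exists_isMaxOn (hne j) (hu j)
  obtain ⟨j, hj⟩ := Finite.exists_max fun j => u j (m j)
  exact ⟨j, m j, hm j, fun k y hy => (hmax k hy).trans (hj k)⟩

/-- At a vertex maximizing `u` on an incident edge, the derivative of `u` pointing into the edge
is nonpositive. -/
theorem sgn_mul_pd_nonpos {u : N.J → ℝ → ℝ} (hu : N.IsC2 u) (i : N.I) (j : N.J)
    (hmax : IsMaxOn (u j) (N.edge j) (N.param i j)) :
    N.sgn i j * N.pd u j (N.param i j) ≤ 0 := by
  have hd := hu.differentiableOn j _ (param_mem_edge i j)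
  have h0 := hmax.derivWithin_mul_sub_nonpos (y := 0) (param_mem_edge i j)
    ⟨le_rfl, (N.l_pos j).le⟩ hd
  have hl := hmax.derivWithin_mul_sub_nonpos (y := N.l j) (param_mem_edge i j)
    ⟨(N.l_pos j).le, le_rfl⟩ hd
  have hpos := N.l_pos j
  change N.pd u j _ * _ ≤ 0 at h0 hl
  unfold sgn param at *
  split_ifs at * <;> nlinarith

open scoped Classical in
/-- A global maximum point outside the boundary is critical, provided the Kirchhoff sums are
nonnegative at the transition vertices. -/
theorem pd_eq_zero_of_max {u : N.J → ℝ → ℝ} (hu : N.IsC2 u) {β : N.I → N.J → ℝ}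
    (hβ : ∀ i ∈ N.IT, ∀ j ∈ N.Inc i, 0 < β i j) (hkir : ∀ i ∈ N.IT, 0 ≤ N.kir β u i)
    {j : N.J} {x : ℝ} (hx : x ∈ N.edge j) (hmax : ∀ k, ∀ y ∈ N.edge k, u k y ≤ u j x)
    (hbd : ∀ i ∈ N.IB, j ∈ N.Inc i → x ≠ N.param i j) : N.pd u j x = 0 := by
  have hvert : ∀ i, j ∈ N.Inc i → x = N.param i j → N.pd u j x = 0 := by
    intro i hj hxi
    have hi : i ∈ N.IT := fun hi => hbd i hi hj hxi
    have hle : ∀ k ∈ N.Inc i, N.sgn i k * N.pd u k (N.param i k) ≤ 0 := by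
      intro k hk
      refine sgn_mul_pd_nonpos hu i k fun y hy => ?_
      have h := hmax k y hy
      rwa [hxi, hu.1 i j hj k hk] at h
    have hterm : ∀ k ∈ Finset.univ, (if k ∈ N.Inc i then
        β i k * N.sgn i k * N.pd u k (N.param i k) else 0) ≤ 0 := by
      intro k _
      split_ifs with hk
      · rw [mul_assoc]
        exact mul_nonpos_of_nonneg_of_nonpos (hβ i hi k hk).le (hle k hk)
      · exact le_rfl
    have hsum := (Finset.sum_eq_zero_iff_of_nonpos hterm).1
      (le_antisymm (Finset.sum_nonpos hterm) (hkir i hi)) j (Finset.mem_univ j)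
    rw [if_pos hj, ← hxi] at hsum
    have hs : N.sgn i j ≠ 0 := by unfold sgn; split_ifs <;> norm_num
    simpa [(hβ i hi j hj).ne', hs] using hsum
  by_cases h0 : x = 0
  · exact hvert (N.s j) (Or.inl rfl) (by simp [param, h0])
  by_cases hl : x = N.l j
  · exact hvert (N.t j) (Or.inr rfl) (by simp [param, hl, N.st_ne j])
  have hx0 : 0 < x := lt_of_le_of_ne hx.1 (Ne.symm h0)
  have hxl : x < N.l j := lt_of_le_of_ne hx.2 hl
  have hloc : IsLocalMax (u j) x :=
    Filter.mem_of_superset (Icc_mem_nhds hx0 hxl) fun y hy => hmax j y hy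
  exact (derivWithin_of_mem_nhds (Icc_mem_nhds hx0 hxl)).trans hloc.deriv_eq_zero

end Network

open Network in
/-- **Proposition 3.6** (comparison principle under strict monotonicity in `u`). -/
theorem comparison_viscous_strict_mono
    (N : Network) (H : N.J → ℝ → ℝ → ℝ → ℝ)
    (hH0 : N.H0 H) (hH1 : N.H1 H)
    (hHr : ∀ j, ∀ y ∈ N.edge j, ∀ p : ℝ, StrictMono fun r => H j y r p)
    (β : N.I → N.J → ℝ)
    (hβ : ∀ i ∈ N.IT, ∀ j ∈ N.Inc i, 0 < β i j)
    (ε : ℝ) (hε : 0 < ε)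
    (w₁ w₂ : N.J → ℝ → ℝ) (hw₁ : N.IsC2 w₁) (hw₂ : N.IsC2 w₂)
    (hCP : N.CP H β ε w₁ w₂) :
    ∀ j, ∀ x ∈ N.edge j, w₂ j x ≤ w₁ j x := by
  obtain ⟨hpde, hkir, hbd⟩ := hCP
  have hu := hw₂.sub hw₁
  obtain ⟨j, x, hx, hmax⟩ := exists_max fun j => (hu.differentiableOn j).continuousOn
  suffices hle : w₂ j x ≤ w₁ j x from fun k y hy => by linarith [hmax k y hy]
  by_contra! hlt
  have hcrit : N.pd (fun j x => w₂ j x - w₁ j x) j x = 0 := by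
    refine pd_eq_zero_of_max hu hβ (fun i hi => ?_) hx hmax fun i hi hj hxi => ?_
    · rw [kir_sub hw₂ hw₁]
      exact sub_nonneg.2 (hkir i hi)
    · exact absurd (hbd i hi j hj) (hxi ▸ hlt).not_ge
  have hsec : N.pd2 (fun j x => w₂ j x - w₁ j x) j x ≤ 0 :=
    IsMaxOn.second_derivWithin_nonpos (N.l_pos j) hx (fun y hy => hmax j y hy)
      (hu.differentiableOn j) hcrit (hu.differentiableOn_pd j x hx).hasDerivWithinAt
  rw [pd2_sub hw₂ hw₁ hx] at hsec
  rw [pd_sub hw₂ hw₁ hx] at hcrit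
  have hH := hpde j x hx
  rw [sub_eq_zero.1 hcrit] at hH
  have hstrict := hHr j x hx (N.pd w₁ j x) hlt
  dsimp only at hstrict
  nlinarith
end
end

section
/- Difference-quotient estimate at a transition vertex (Lemma 5.3). Assume the Hamiltonian H = (H^j) satisfies (H0)–(H6) and β_{ij} > 0 for all i ∈ I_T, j ∈ Inc_i. Let ε_n > 0 with ε_n → 0 and let u_n ∈ C²_{*,β}(Γ) satisfy −ε_n ∂²_j u_n + H^j(x, u_n, ∂_j u_n) = 0 on (0,l_j) for all j ∈ J and S^i_β u_n = 0 for all i ∈ I_T; assume (u_n) and (∂_j u_n) are uniformly bounded on Γ and u_n → u uniformly on Γ with u ∈ C(Γ). Fix i ∈ I_T, j ∈ Inc_i, ξ > 0, and a sequence of points x_m in the interior of edge e_j with parameters y_m ∈ (0,l_j) converging to y_i^j. Then there exists m_ξ ∈ ℕ such that for all m > m_ξ: H^j( y_i^j, u(v_i), (u^j(y_m) − u(v_i)) / |y_m − y_i^j| ) ≤ ξ. -/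
open Set

noncomputable section

section

open Filter Topology

/-- A bounded solution of `e * w' ≥ h (w) - ξ / 2` that starts at a nonnegative value above the
sublevel set `{h ≤ ξ}` grows linearly with slope `ξ / (2 * e)`, so it cannot exist for long. -/
lemma sublevel_of_growth_right {h w w' : ℝ → ℝ} {e ξ C x₀ b : ℝ}
    (hmono : MonotoneOn h (Ici 0)) (he : 0 < e) (hξ : 0 < ξ) (hxb : x₀ ≤ b)
    (hw : ∀ x ∈ Icc x₀ b, HasDerivAt w (w' x) x)
    (hode : ∀ x ∈ Icc x₀ b, h (w x) - ξ / 2 ≤ e * w' x)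
    (hC : ∀ x ∈ Icc x₀ b, |w x| ≤ C)
    (hlong : e * (2 * C) < ξ / 2 * (b - x₀)) (h0 : 0 ≤ w x₀) : h (w x₀) ≤ ξ := by
  by_contra! hlt
  have hk : 0 < ξ / (2 * e) := by positivity
  have key : w x₀ + ξ / (2 * e) * (b - x₀) ≤ w b := by
    refine image_le_of_deriv_right_lt_deriv_boundary'
      (f := fun x => w x₀ + ξ / (2 * e) * (x - x₀)) (f' := fun _ => ξ / (2 * e))
      (B := w) (B' := w') (a := x₀) (b := b) (by fun_prop) ?_ (by simp) ?_ ?_ ?_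
      (right_mem_Icc.2 hxb)
    · intro x _
      simpa using ((((hasDerivAt_id x).sub_const x₀).const_mul (ξ / (2 * e))).const_add
        (w x₀)).hasDerivWithinAt
    · exact fun x hx => (hw x hx).continuousAt.continuousWithinAt
    · exact fun x hx => (hw x (Ico_subset_Icc_self hx)).hasDerivWithinAt
    · intro x hx hxw
      have hge : w x₀ ≤ w x := by
        have := mul_nonneg hk.le (sub_nonneg.2 hx.1)
        linarith
      have h1 := hmono (mem_Ici.2 h0) (mem_Ici.2 (h0.trans hge)) hge
      have h2 := hode x (Ico_subset_Icc_self hx)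
      rw [div_lt_iff₀ (by positivity)]
      linarith
  have h1 := (abs_le.1 (hC x₀ (left_mem_Icc.2 hxb))).1
  have h2 := (abs_le.1 (hC b (right_mem_Icc.2 hxb))).2
  have h3 : ξ / (2 * e) * (b - x₀) ≤ 2 * C := by linarith
  have h4 : e * (ξ / (2 * e) * (b - x₀)) = ξ / 2 * (b - x₀) := by
    field_simp
  have h5 := mul_le_mul_of_nonneg_left h3 he.le
  linarith

/-- For even `h`, bounded solutions of `e * w' ≥ h (w) - ξ / 2` lie in `{h ≤ ξ}` away from the
endpoints of the interval of existence. -/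
lemma sublevel_of_growth {h w w' : ℝ → ℝ} {e ξ C a x₀ b : ℝ}
    (hmono : MonotoneOn h (Ici 0)) (heven : ∀ p, h p = h (-p)) (he : 0 < e) (hξ : 0 < ξ)
    (hax : a ≤ x₀) (hxb : x₀ ≤ b)
    (hw : ∀ x ∈ Icc a b, HasDerivAt w (w' x) x)
    (hode : ∀ x ∈ Icc a b, h (w x) - ξ / 2 ≤ e * w' x)
    (hC : ∀ x ∈ Icc a b, |w x| ≤ C)
    (hlongl : e * (2 * C) < ξ / 2 * (x₀ - a)) (hlongr : e * (2 * C) < ξ / 2 * (b - x₀)) :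
    h (w x₀) ≤ ξ := by
  rcases le_total 0 (w x₀) with h0 | h0
  · have hsub : Icc x₀ b ⊆ Icc a b := Icc_subset_Icc_left hax
    exact sublevel_of_growth_right hmono he hξ hxb (fun x hx => hw x (hsub hx))
      (fun x hx => hode x (hsub hx)) (fun x hx => hC x (hsub hx)) hlongr h0
  · have hsub : ∀ x ∈ Icc (-x₀) (-a), -x ∈ Icc a b := fun x hx =>
      ⟨by linarith [hx.2], by linarith [hx.1]⟩
    have := sublevel_of_growth_right (h := h) (w := fun x => -w (-x)) (w' := fun x => w' (-x))
      (C := C) (x₀ := -x₀) (b := -a) hmono he hξ (by linarith)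
      (fun x hx => ((hw (-x) (hsub x hx)).comp x (hasDerivAt_neg x)).neg.congr_deriv (by ring))
      (fun x hx => by rw [← heven]; exact hode (-x) (hsub x hx))
      (fun x hx => by simpa using hC (-x) (hsub x hx))
      (by linarith) (by simpa using h0)
    rw [neg_neg, ← heven] at this
    exact this

/-- Vanishing viscosity limits have difference quotients in the sublevel set of the
Hamiltonian. -/
lemma sublevel_diff_quotient_of_tendsto {h : ℝ → ℝ} {ε : ℕ → ℝ} {U W W' : ℕ → ℝ → ℝ} {V : ℝ → ℝ}
    {ξ C c d : ℝ} (hcont : Continuous h)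
    (hmono : MonotoneOn h (Ici 0)) (heven : ∀ p, h p = h (-p)) (hξ : 0 < ξ)
    (hεpos : ∀ n, 0 < ε n) (hεlim : Tendsto ε atTop (𝓝 0))
    (hU : ∀ n, ∀ x ∈ Ioo c d, HasDerivAt (U n) (W n x) x)
    (hW : ∀ n, ∀ x ∈ Ioo c d, HasDerivAt (W n) (W' n x) x)
    (hC : ∀ n, ∀ x ∈ Ioo c d, |W n x| ≤ C)
    (hode : ∀ᶠ n in atTop, ∀ x ∈ Ioo c d, h (W n x) - ξ / 2 ≤ ε n * W' n x)
    (hlim : ∀ x ∈ Ioo c d, Tendsto (fun n => U n x) atTop (𝓝 (V x)))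
    {a b : ℝ} (ha : a ∈ Ioo c d) (hb : b ∈ Ioo c d) (hab : a < b) :
    h ((V b - V a) / (b - a)) ≤ ξ := by
  have ht : Tendsto (fun n => h ((U n b - U n a) / (b - a))) atTop
      (𝓝 (h ((V b - V a) / (b - a)))) :=
    (hcont.tendsto _).comp (((hlim b hb).sub (hlim a ha)).div_const _)
  refine le_of_tendsto ht ?_
  have hsmall : Tendsto (fun n => ε n * (2 * C)) atTop (𝓝 0) := by
    simpa using hεlim.mul_const (2 * C)
  have hl : 0 < ξ / 2 * (a - (c + a) / 2) :=
    mul_pos (by positivity) (by linarith [ha.1])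
  have hr : 0 < ξ / 2 * ((b + d) / 2 - b) :=
    mul_pos (by positivity) (by linarith [hb.2])
  filter_upwards [hode, hsmall.eventually_lt_const hl, hsmall.eventually_lt_const hr]
    with n hn hnl hnr
  have hsub : Icc a b ⊆ Ioo c d := fun x hx => ⟨ha.1.trans_le hx.1, hx.2.trans_lt hb.2⟩
  obtain ⟨z, hz, hzeq⟩ := exists_hasDerivAt_eq_slope (U n) (W n) hab
    (fun x hx => (hU n x (hsub hx)).continuousAt.continuousWithinAt)
    (fun x hx => hU n x (hsub (Ioo_subset_Icc_self hx)))
  rw [← hzeq]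
  have hsub' : Icc ((c + a) / 2) ((b + d) / 2) ⊆ Ioo c d := fun x hx =>
    ⟨by linarith [hx.1, ha.1], by linarith [hx.2, hb.2]⟩
  refine sublevel_of_growth hmono heven (hεpos n) hξ (a := (c + a) / 2) (b := (b + d) / 2)
    (by linarith [hz.1, ha.1]) (by linarith [hz.2, hb.2])
    (fun x hx => hW n x (hsub' hx)) (fun x hx => hn x (hsub' hx)) (fun x hx => hC n x (hsub' hx))
    (hnl.trans_le ?_) (hnr.trans_le ?_)
  · exact mul_le_mul_of_nonneg_left (by linarith [hz.1]) (by positivity)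
  · exact mul_le_mul_of_nonneg_left (by linarith [hz.2]) (by positivity)

/-- A continuous function of three variables is uniformly close to its restriction to a fixed
value of the first two, when the third ranges over a bounded set. -/
lemma exists_delta_of_continuousOn {F : ℝ → ℝ → ℝ → ℝ} {s : Set ℝ} (hs : IsCompact s)
    (hF : ContinuousOn (fun q : ℝ × ℝ × ℝ => F q.1 q.2.1 q.2.2)
      (s ×ˢ (univ : Set ℝ) ×ˢ (univ : Set ℝ)))
    {x₀ : ℝ} (hx₀ : x₀ ∈ s) (r₀ C : ℝ) {η : ℝ} (hη : 0 < η) :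
    ∃ δ > 0, ∀ x ∈ s, |x - x₀| < δ → ∀ r, |r - r₀| < δ → ∀ p, |p| ≤ C →
      |F x r p - F x₀ r₀ p| < η := by
  have hK : IsCompact (s ×ˢ Icc (r₀ - 1) (r₀ + 1) ×ˢ Icc (-C) C) :=
    hs.prod (isCompact_Icc.prod isCompact_Icc)
  have huc := hK.uniformContinuousOn_of_continuous
    (hF.mono (prod_mono Subset.rfl (prod_mono (subset_univ _) (subset_univ _))))
  obtain ⟨δ, hδ, hδF⟩ := Metric.uniformContinuousOn_iff.1 huc η hη
  refine ⟨min δ 1, by positivity, fun x hx hxx r hr p hp => ?_⟩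
  have hp' := abs_le.1 hp
  have hr1 := abs_lt.1 (hr.trans_le (min_le_right _ _))
  refine hδF (x, r, p) ⟨hx, ⟨by linarith [hr1.1], by linarith [hr1.2]⟩, hp'⟩
    (x₀, r₀, p) ⟨hx₀, ⟨by simp, by simp⟩, hp'⟩ ?_
  simp only [Prod.dist_eq, dist_self, Real.dist_eq]
  exact max_lt (hxx.trans_le (min_le_left _ _))
    (max_lt (hr.trans_le (min_le_left _ _)) hδ)

lemma Network.param_mem_edge_s12 (N : Network) (i : N.I) (j : N.J) : N.param i j ∈ N.edge j := by
  have := N.l_pos j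
  unfold Network.param Network.edge
  split_ifs
  · exact left_mem_Icc.2 this.le
  · exact right_mem_Icc.2 this.le

/-- One-sided neighbourhoods of a vertex in the interior of an incident edge. -/
lemma Network.exists_Ioo_near_param (N : Network) (i : N.I) (j : N.J) {δ : ℝ} (hδ : 0 < δ) :
    ∃ c d, Ioo c d ⊆ Ioo 0 (N.l j) ∧ N.param i j ∈ closure (Ioo c d) ∧
      (∀ x ∈ Ioo c d, |x - N.param i j| < δ) ∧
      ∃ δ' > 0, ∀ x ∈ Ioo 0 (N.l j), |x - N.param i j| < δ' → x ∈ Ioo c d := by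
  have hl := N.l_pos j
  have hmin : 0 < min δ (N.l j) := lt_min hδ hl
  have h1 := min_le_left δ (N.l j)
  have h2 := min_le_right δ (N.l j)
  unfold Network.param
  split_ifs
  · refine ⟨0, min δ (N.l j), Ioo_subset_Ioo_right h2, ?_, fun x hx => ?_, _, hmin,
      fun x hx hx' => ?_⟩
    · rw [closure_Ioo hmin.ne]
      exact left_mem_Icc.2 hmin.le
    · rw [sub_zero, abs_of_pos hx.1]
      exact hx.2.trans_le h1
    · rw [sub_zero, abs_of_pos hx.1] at hx'
      exact ⟨hx.1, hx'⟩
  · refine ⟨N.l j - min δ (N.l j), N.l j, Ioo_subset_Ioo_left (by linarith), ?_, fun x hx => ?_, _,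
      hmin, fun x hx hx' => ?_⟩
    · rw [closure_Ioo (by linarith)]
      exact right_mem_Icc.2 (by linarith)
    · rw [abs_lt]
      constructor <;> linarith [hx.1, hx.2]
    · exact ⟨by linarith [(abs_lt.1 hx').1], hx.2⟩

/-- Monotonicity on `(0, ∞)` of a continuous function extends to `[0, ∞)`. -/
lemma MonotoneOn.Ici_of_Ioi {h : ℝ → ℝ} {a : ℝ} (hm : MonotoneOn h (Ioi a)) (hc : Continuous h) :
    MonotoneOn h (Ici a) := by
  intro p hp q hq hpq
  rcases eq_or_lt_of_le (mem_Ici.1 hp) with rfl | hp'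
  · rcases eq_or_lt_of_le hpq with rfl | hlt
    · exact le_rfl
    · refine le_of_tendsto ((hc.tendsto a).mono_left nhdsWithin_le_nhds : Tendsto h (𝓝[>] a) _) ?_
      filter_upwards [Ioo_mem_nhdsGT hlt] with x hx
      exact hm hx.1 hlt hx.2.le
  · exact hm hp' (hp'.trans_le hpq) hpq

lemma Network.IsC2.hasDerivAt {N : Network} {u : N.J → ℝ → ℝ} (hu : N.IsC2 u) (j : N.J) {x : ℝ}
    (hx : x ∈ Ioo 0 (N.l j)) :
    HasDerivAt (u j) (N.pd u j x) x ∧ HasDerivAt (N.pd u j) (N.pd2 u j x) x := by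
  have hmem : N.edge j ∈ 𝓝 x := Icc_mem_nhds hx.1 hx.2
  have hxe : x ∈ N.edge j := Ioo_subset_Icc_self hx
  have hun : UniqueDiffOn ℝ (N.edge j) := uniqueDiffOn_Icc (N.l_pos j)
  have h1 : DifferentiableOn ℝ (u j) (N.edge j) := (hu.2 j).differentiableOn (by norm_num)
  have h2 : DifferentiableOn ℝ (N.pd u j) (N.edge j) :=
    ((hu.2 j).derivWithin hun (m := 1) (by norm_num)).differentiableOn (by norm_num)
  exact ⟨(h1 x hxe).hasDerivWithinAt.hasDerivAt hmem, (h2 x hxe).hasDerivWithinAt.hasDerivAt hmem⟩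

end

open Network in
/-- **Lemma 5.3** (difference-quotient estimate at a transition vertex). -/
theorem difference_quotient_estimate
    (N : Network) (H : N.J → ℝ → ℝ → ℝ → ℝ)
    (hH0 : N.H0 H) (hH1 : N.H1 H) (hH3 : N.H3 H) (hH4 : N.H4 H)
    (hH5 : N.H5 H) (hH6 : N.H6 H)
    (β : N.I → N.J → ℝ)
    (hβ : ∀ i ∈ N.IT, ∀ j ∈ N.Inc i, 0 < β i j)
    (ε : ℕ → ℝ) (hεpos : ∀ n, 0 < ε n)
    (hεlim : Filter.Tendsto ε Filter.atTop (nhds 0))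
    (u : ℕ → N.J → ℝ → ℝ)
    (hsol : ∀ n, N.IsC2Star β (u n) ∧
      ∀ j, ∀ x ∈ Set.Ioo (0 : ℝ) (N.l j),
        -(ε n) * N.pd2 (u n) j x + H j x (u n j x) (N.pd (u n) j x) = 0)
    (hbd : ∃ C : ℝ, ∀ n, ∀ j, ∀ x ∈ N.edge j,
      |u n j x| ≤ C ∧ |N.pd (u n) j x| ≤ C)
    (v : N.J → ℝ → ℝ) (hv : N.IsCont v)
    (hconv : ∀ j, TendstoUniformlyOn (fun n => u n j) (v j) Filter.atTop (N.edge j))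
    (i : N.I) (hi : i ∈ N.IT) (j : N.J) (hj : j ∈ N.Inc i)
    (ξ : ℝ) (hξ : 0 < ξ)
    (y : ℕ → ℝ) (hy : ∀ m, y m ∈ Set.Ioo (0 : ℝ) (N.l j))
    (hylim : Filter.Tendsto y Filter.atTop (nhds (N.param i j))) :
    ∃ mξ : ℕ, ∀ m > mξ,
      H j (N.param i j) (v j (N.param i j))
        ((v j (y m) - v j (N.param i j)) / |y m - N.param i j|) ≤ ξ := by
  obtain ⟨C, hC⟩ := hbd
  set x₀ := N.param i j with hx₀def
  set h : ℝ → ℝ := H j x₀ (v j x₀) with hdef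
  have hx₀ : x₀ ∈ N.edge j := N.param_mem_edge_s12 i j
  have hcont : Continuous h := by
    rw [← continuousOn_univ]
    exact (hH0 j).comp (f := fun p : ℝ => (x₀, v j x₀, p)) (by fun_prop)
      (fun p _ => ⟨hx₀, mem_univ _, mem_univ _⟩)
  have hmono : MonotoneOn h (Ici 0) := (hH3 i hi j hj (v j x₀)).Ici_of_Ioi hcont
  have heven : ∀ p, h p = h (-p) := hH6 i hi j hj (v j x₀)
  obtain ⟨δ, hδ, hδH⟩ := exists_delta_of_continuousOn isCompact_Icc (hH0 j) hx₀ (v j x₀) C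
    (half_pos hξ)
  obtain ⟨δ₁, hδ₁, hδv⟩ := Metric.continuousOn_iff.1 (hv.2 j) x₀ hx₀ (δ / 2) (half_pos hδ)
  obtain ⟨c, d, hcd, hclos, hnear, δ₂, hδ₂, hin⟩ :=
    N.exists_Ioo_near_param i j (lt_min hδ hδ₁)
  have hcde : Ioo c d ⊆ N.edge j := hcd.trans Ioo_subset_Icc_self
  have hode : ∀ᶠ n in Filter.atTop, ∀ x ∈ Ioo c d,
      h (N.pd (u n) j x) - ξ / 2 ≤ ε n * N.pd2 (u n) j x := by
    filter_upwards [Metric.tendstoUniformlyOn_iff.1 (hconv j) (δ / 2) (half_pos hδ)] with n hn x hx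
    have hxe := hcde hx
    have h1 := hn x hxe
    have h2 := hδv x hxe ((hnear x hx).trans_le (min_le_right _ _))
    have h3 : |u n j x - v j x₀| < δ := by
      rw [← Real.dist_eq]
      have := dist_triangle_left (u n j x) (v j x₀) (v j x)
      linarith
    have h4 := hδH x hxe ((hnear x hx).trans_le (min_le_left _ _)) _ h3 _ (hC n j x hxe).2
    have h5 := (hsol n).2 j x (hcd hx)
    have h6 := (abs_lt.1 h4).1
    linarith
  have hquot : ∀ a ∈ Ioo c d, ∀ b ∈ Ioo c d, a < b → h ((v j b - v j a) / (b - a)) ≤ ξ :=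
    fun a ha b hb hab => sublevel_diff_quotient_of_tendsto hcont hmono heven hξ hεpos hεlim
      (fun n x hx => ((hsol n).1.1.hasDerivAt j (hcd hx)).1)
      (fun n x hx => ((hsol n).1.1.hasDerivAt j (hcd hx)).2)
      (fun n x hx => (hC n j x (hcde hx)).2) hode
      (fun x hx => (hconv j).tendsto_at (hcde hx)) ha hb hab
  have hvertex : ∀ b ∈ Ioo c d, b ≠ x₀ → h ((v j b - v j x₀) / (b - x₀)) ≤ ξ := by
    intro b hb hne
    have := mem_closure_iff_nhdsWithin_neBot.1 hclos
    have hvlim : Filter.Tendsto (v j) (nhdsWithin x₀ (Ioo c d)) (nhds (v j x₀)) := (hv.2 j x₀ hx₀).mono hcde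
    have hidlim : Filter.Tendsto (fun a : ℝ => a) (nhdsWithin x₀ (Ioo c d)) (nhds x₀) :=
      Filter.tendsto_id.mono_left nhdsWithin_le_nhds
    have hlim : Filter.Tendsto (fun a => h ((v j b - v j a) / (b - a))) (nhdsWithin x₀ (Ioo c d))
        (nhds (h ((v j b - v j x₀) / (b - x₀)))) :=
      (hcont.tendsto _).comp ((hvlim.const_sub _).div (hidlim.const_sub _) (sub_ne_zero.2 hne))
    refine le_of_tendsto hlim ?_
    filter_upwards [self_mem_nhdsWithin, hidlim.eventually_ne hne.symm] with a ha hab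
    rcases lt_or_gt_of_ne hab with hlt | hlt
    · exact hquot a ha b hb hlt
    · have := hquot b hb a ha hlt
      rwa [← neg_sub (v j b), ← neg_sub b, neg_div_neg_eq] at this
  obtain ⟨M, hM⟩ := Metric.tendsto_atTop.1 hylim δ₂ hδ₂
  refine ⟨M, fun m hm => ?_⟩
  have hym : y m ∈ Ioo c d := hin _ (hy m) (hM m hm.le)
  have hne : y m ≠ x₀ := by
    have h0 := hy m
    rw [hx₀def, Network.param]
    split_ifs
    · exact h0.1.ne'
    · exact h0.2.ne
  have hq := hvertex _ hym hne
  rcases abs_choice (y m - x₀) with habs | habs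
  · rw [habs]
    exact hq
  · rw [habs, div_neg]
    exact (heven _).symm.trans_le hq
end
end
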